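/- Let G be a finite directed graph, k a positive integer, and u, v distinct vertices of G such that G has an arc (u, v) or (v, u). Then for every u-directed tree T in G with k arcs and every v-directed tree T' in G with k arcs, there exists a reconfiguration sequence between T and T' in which every intermediate subgraph is a directed tree in G with k arcs. -/

import Mathlib

/-- The vertex set of a set of arcs. -/
def arcVerts {V : Type*} [DecidableEq V] (T : Finset (V × V)) : Finset V :=
  T.image Prod.fst ∪ T.image Prod.snd

/-- The in-degree of a vertex `v` in a set of arcs `T`. -/
def inDeg {V : Type*} [DecidableEq V] (T : Finset (V × V)) (v : V) : ℕ :=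
  (T.filter fun e => e.2 = v).card

/-- The step relation of a set of arcs: `arcRel T a b` iff `(a, b)` is an arc of `T`. -/
def arcRel {V : Type*} (T : Finset (V × V)) : V → V → Prop := fun a b => (a, b) ∈ T

/-- `T` is (the arc set of) a directed tree rooted at `r`: the root has in-degree `0`,
every other vertex has in-degree exactly `1`, and every vertex is reachable from `r`. -/
def IsDirTree {V : Type*} [DecidableEq V] (T : Finset (V × V)) (r : V) : Prop :=
  inDeg T r = 0 ∧ (∀ v ∈ arcVerts T, v ≠ r → inDeg T v = 1) ∧
    ∀ v ∈ arcVerts T, Relation.ReflTransGen (arcRel T) r v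

open Relation Finset

/-- An arc-wise description of an `r`-directed tree: no arc enters `r`, at most one arc enters
each vertex, and the tail of every arc is reachable from `r`. -/
structure IsArborescence {V : Type*} (T : Finset (V × V)) (r : V) : Prop where
  not_mem_root : ∀ a, (a, r) ∉ T
  tail_unique : ∀ a b y, (a, y) ∈ T → (b, y) ∈ T → a = b
  reach_tail : ∀ a b, (a, b) ∈ T → ReflTransGen (arcRel T) r a

theorem reflTransGen_arcRel_mono {V : Type*} {S T : Finset (V × V)} (h : S ⊆ T) {a b : V}
    (hab : ReflTransGen (arcRel S) a b) : ReflTransGen (arcRel T) a b :=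
  ReflTransGen.mono (p := arcRel T) (fun _ _ hxy => h hxy) a b hab

theorem isArborescence_empty {V : Type*} (r : V) : IsArborescence (∅ : Finset (V × V)) r := by
  constructor <;> simp

section

variable {V : Type*} [DecidableEq V]

theorem mem_arcVerts {T : Finset (V × V)} {x : V} :
    x ∈ arcVerts T ↔ (∃ y, (x, y) ∈ T) ∨ ∃ y, (y, x) ∈ T := by
  simp [arcVerts]

theorem isDirTree_iff_isArborescence {T : Finset (V × V)} {r : V} :
    IsDirTree T r ↔ IsArborescence T r := by
  constructor
  · rintro ⟨h0, h1, h2⟩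
    have hr : ∀ a, (a, r) ∉ T := by
      intro a ha
      rw [inDeg, card_eq_zero, filter_eq_empty_iff] at h0
      exact h0 ha rfl
    refine ⟨hr, ?_, fun a b hab => h2 a (mem_arcVerts.2 (Or.inl ⟨b, hab⟩))⟩
    intro a b y ha hb
    have hy : y ≠ r := by
      rintro rfl
      exact hr a ha
    have h := h1 y (mem_arcVerts.2 (Or.inr ⟨a, ha⟩)) hy
    rw [inDeg] at h
    exact congrArg Prod.fst (card_le_one.1 h.le (a, y) (mem_filter.2 ⟨ha, rfl⟩) (b, y)
      (mem_filter.2 ⟨hb, rfl⟩))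
  · rintro ⟨h0, h1, h2⟩
    have hreach : ∀ x ∈ arcVerts T, ReflTransGen (arcRel T) r x := by
      intro x hx
      rcases mem_arcVerts.1 hx with ⟨y, hy⟩ | ⟨y, hy⟩
      · exact h2 x y hy
      · exact (h2 y x hy).tail hy
    refine ⟨?_, ?_, hreach⟩
    · rw [inDeg, card_eq_zero, filter_eq_empty_iff]
      rintro ⟨a, b⟩ hab rfl
      exact h0 a hab
    · intro x hx hxr
      rcases (hreach x hx).cases_tail with h | ⟨p, -, hp⟩
      · exact absurd h hxr
      · rw [inDeg, card_eq_one]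
        refine ⟨(p, x), ?_⟩
        ext ⟨a, b⟩
        simp only [mem_filter, mem_singleton, Prod.mk.injEq]
        constructor
        · rintro ⟨hab, rfl⟩
          exact ⟨h1 a p b hab hp, rfl⟩
        · rintro ⟨rfl, rfl⟩
          exact ⟨hp, rfl⟩

namespace IsArborescence

variable {F S T : Finset (V × V)} {r u x y z : V}

theorem insert_arc (hT : IsArborescence T r) (hx : ReflTransGen (arcRel T) r x) (hy : y ≠ r)
    (hin : ∀ a, (a, y) ∉ T) : IsArborescence (insert (x, y) T) r := by
  refine ⟨?_, ?_, ?_⟩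
  · intro a ha
    rcases mem_insert.1 ha with h | h
    · exact hy (congrArg Prod.snd h).symm
    · exact hT.not_mem_root a h
  · intro a b c ha hb
    simp only [mem_insert, Prod.mk.injEq] at ha hb
    rcases ha with ⟨rfl, rfl⟩ | ha <;> rcases hb with ⟨rfl, hb⟩ | hb
    · rfl
    · exact absurd hb (hin b)
    · exact absurd (hb ▸ ha) (hin a)
    · exact hT.tail_unique a b c ha hb
  · intro a b hab
    apply reflTransGen_arcRel_mono (subset_insert _ T)
    simp only [mem_insert, Prod.mk.injEq] at hab
    rcases hab with ⟨rfl, rfl⟩ | hab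
    · exact hx
    · exact hT.reach_tail a b hab

theorem exists_arc_of_ssubset (hT : IsArborescence T r) (hFT : F ⊂ T) :
    ∃ x y, (x, y) ∈ T ∧ (x, y) ∉ F ∧ ReflTransGen (arcRel F) r x := by
  obtain ⟨⟨a, b⟩, hab, habF⟩ := exists_of_ssubset hFT
  by_contra! hcon
  have key : ∀ c, ReflTransGen (arcRel T) r c → ReflTransGen (arcRel F) r c := by
    intro c hc
    induction hc with
    | refl => exact .refl
    | @tail b c _ hbc ih =>
      by_cases h : (b, c) ∈ F
      · exact ih.tail h
      · exact absurd ih (hcon b c hbc h)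
  exact hcon a b hab habF (key a (hT.reach_tail a b hab))

theorem insert_of_subset (hT : IsArborescence T r) (hF : IsArborescence F r) (hFT : F ⊆ T)
    (hxT : (x, y) ∈ T) (hxF : (x, y) ∉ F) (hx : ReflTransGen (arcRel F) r x) :
    IsArborescence (insert (x, y) F) r := by
  refine hF.insert_arc hx ?_ ?_
  · rintro rfl
    exact hT.not_mem_root x hxT
  · intro a ha
    obtain rfl := hT.tail_unique a x y (hFT ha) hxT
    exact hxF ha

/-- A directed tree properly containing another one with the same root has a leaf arc outside
the smaller tree. -/
theorem exists_erase (hT : IsArborescence T r) (hF : IsArborescence F r) (hFT : F ⊂ T) :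
    ∃ e ∈ T, F ⊆ T.erase e ∧ IsArborescence (T.erase e) r := by
  induction hn : T.card - F.card generalizing F with
  | zero => have := card_lt_card hFT; omega
  | succ n ih =>
    obtain ⟨x, y, hxT, hxF, hx⟩ := hT.exists_arc_of_ssubset hFT
    have hF' := hT.insert_of_subset hF hFT.1 hxT hxF hx
    rcases (insert_subset hxT hFT.1).eq_or_ssubset with h | h
    · have : T.erase (x, y) = F := by rw [← h, erase_insert hxF]
      exact ⟨(x, y), hxT, this.ge, this ▸ hF⟩
    · obtain ⟨e, he, hsub, hE⟩ := ih hF' h (by rw [card_insert_of_notMem hxF]; omega)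
      exact ⟨e, he, (subset_insert _ _).trans hsub, hE⟩

theorem swap_head (hT : IsArborescence T r) (hF : F ⊆ T.erase (z, y))
    (hx : ReflTransGen (arcRel F) r x) (hz : (z, y) ∈ T) :
    IsArborescence (insert (x, y) (T.erase (z, y))) r := by
  have hyr : y ≠ r := by
    rintro rfl
    exact hT.not_mem_root z hz
  have hreach : ∀ a, ReflTransGen (arcRel T) r a →
      ReflTransGen (arcRel (insert (x, y) (T.erase (z, y)))) r a := by
    intro a ha
    induction ha with
    | refl => exact .refl
    | @tail b c _ hbc ih =>
      by_cases h : (b, c) = (z, y)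
      · obtain ⟨rfl, rfl⟩ := Prod.mk.inj h
        exact (reflTransGen_arcRel_mono (hF.trans (subset_insert _ _)) hx).tail
          (mem_insert_self _ _)
      · exact ih.tail (mem_insert_of_mem (mem_erase.2 ⟨h, hbc⟩))
  refine ⟨?_, ?_, ?_⟩
  · intro a ha
    rcases mem_insert.1 ha with h | h
    · exact hyr (congrArg Prod.snd h).symm
    · exact hT.not_mem_root a (mem_of_mem_erase h)
  · have := hT.tail_unique
    intro a b c ha hb
    simp only [mem_insert, mem_erase, Prod.mk.injEq] at ha hb
    grind
  · intro a b hab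
    rcases mem_insert.1 hab with h | h
    · obtain ⟨rfl, rfl⟩ := Prod.mk.inj h
      exact reflTransGen_arcRel_mono (hF.trans (subset_insert _ _)) hx
    · exact hreach a (hT.reach_tail a b (mem_of_mem_erase h))

/-- Adding an arc from a vertex `u` to the root `r` and deleting the arc into `u`
moves the root to `u`. -/
theorem insert_root (hST : S ⊆ T) (hT : IsArborescence T r) (hur : u ≠ r)
    (hin : ∀ a, (a, u) ∉ S) (hS : ∀ a b, (a, b) ∈ T → b ≠ u → (a, b) ∈ S) :
    IsArborescence (insert (u, r) S) u := by
  have hreach : ∀ a, ReflTransGen (arcRel T) r a →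
      ReflTransGen (arcRel (insert (u, r) S)) u a := by
    intro a ha
    induction ha with
    | refl => exact .single (mem_insert_self _ _)
    | @tail b c _ hbc ih =>
      by_cases h : c = u
      · exact h ▸ .refl
      · exact ih.tail (mem_insert_of_mem (hS b c hbc h))
  refine ⟨?_, ?_, ?_⟩
  · intro a ha
    rcases mem_insert.1 ha with h | h
    · exact hur (congrArg Prod.snd h)
    · exact hin a h
  · have h1 := hT.tail_unique
    have h2 := hT.not_mem_root
    intro a b c ha hb
    simp only [mem_insert, Prod.mk.injEq] at ha hb
    grind
  · intro a b hab
    rcases mem_insert.1 hab with h | h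
    · rw [(Prod.mk.inj h).1]
    · exact hreach a (hT.reach_tail a b (hST h))

end IsArborescence

/-- `S` is a directed tree with `k` arcs contained in the arc set `A`. -/
def IsTreeIn (A : Finset (V × V)) (k : ℕ) (S : Finset (V × V)) : Prop :=
  S ⊆ A ∧ (∃ r, IsDirTree S r) ∧ S.card = k

/-- One step of a reconfiguration sequence of directed trees with `k` arcs in `A`. -/
def ReconfStep (A : Finset (V × V)) (k : ℕ) (S T : Finset (V × V)) : Prop :=
  IsTreeIn A k S ∧ IsTreeIn A k T ∧ (S \ T).card = 1 ∧ (T \ S).card = 1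

instance (A : Finset (V × V)) (k : ℕ) : Std.Symm (ReconfStep A k) :=
  ⟨fun _ _ ⟨hS, hT, h1, h2⟩ => ⟨hT, hS, h2, h1⟩⟩

theorem card_insert_erase {α : Type*} [DecidableEq α] {S : Finset α} {e e' : α} (he : e ∈ S)
    (he' : e' ∉ S) : (insert e' (S.erase e)).card = S.card := by
  rw [card_insert_of_notMem fun h => he' (mem_of_mem_erase h), card_erase_add_one he]

theorem reconfStep_swap {A S : Finset (V × V)} {e e' : V × V} {r r' : V} (hSA : S ⊆ A)
    (hS : IsArborescence S r) (he : e ∈ S) (he' : e' ∉ S) (heA : e' ∈ A)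
    (hT : IsArborescence (insert e' (S.erase e)) r') :
    ReconfStep A S.card S (insert e' (S.erase e)) := by
  refine ⟨⟨hSA, ⟨r, isDirTree_iff_isArborescence.2 hS⟩, rfl⟩,
    ⟨insert_subset heA ((erase_subset _ _).trans hSA),
      ⟨r', isDirTree_iff_isArborescence.2 hT⟩, card_insert_erase he he'⟩, ?_, ?_⟩
  · rw [card_eq_one]
    refine ⟨e, ?_⟩
    ext x
    simp only [mem_sdiff, mem_insert, mem_erase, mem_singleton]
    grind
  · rw [card_eq_one]
    refine ⟨e', ?_⟩
    ext x
    simp only [mem_sdiff, mem_insert, mem_erase, mem_singleton]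
    grind

theorem reconf_of_common_subtree {A F S T : Finset (V × V)} {r : V} (hSA : S ⊆ A) (hTA : T ⊆ A)
    (hS : IsArborescence S r) (hT : IsArborescence T r) (hcard : S.card = T.card)
    (hF : IsArborescence F r) (hFS : F ⊆ S) (hFT : F ⊆ T) :
    ReflTransGen (ReconfStep A T.card) S T := by
  induction hn : T.card - F.card generalizing F S with
  | zero =>
    have hFT' := eq_of_subset_of_card_le hFT (by omega)
    subst hFT'
    rw [eq_of_subset_of_card_le hFS hcard.le]
  | succ n ih =>
    have hssub : F ⊂ T := hFT.ssubset_of_ne (by rintro rfl; omega)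
    have hssub' : F ⊂ S := hFS.ssubset_of_ne (by rintro rfl; omega)
    obtain ⟨x, y, hxT, hxF, hx⟩ := hT.exists_arc_of_ssubset hssub
    have hF' := hT.insert_of_subset hF hFT hxT hxF hx
    have hn' : T.card - (insert (x, y) F).card = n := by
      rw [card_insert_of_notMem hxF]; omega
    by_cases hxS : (x, y) ∈ S
    · exact ih hSA hS hcard hF' (insert_subset hxS hFS) (insert_subset hxT hFT) hn'
    have step : ∀ e ∈ S, F ⊆ S.erase e → IsArborescence (insert (x, y) (S.erase e)) r →
        ReflTransGen (ReconfStep A T.card) S T := by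
      intro e he hFe harb
      have hstep := reconfStep_swap hSA hS he hxS (hTA hxT) harb
      exact .head (hcard ▸ hstep) (ih hstep.2.1.1 harb ((card_insert_erase he hxS).trans hcard)
        hF' (insert_subset_insert _ hFe) (insert_subset hxT hFT) hn')
    by_cases hy : ∃ z, (z, y) ∈ S
    · obtain ⟨z, hz⟩ := hy
      have hzF : (z, y) ∉ F := by
        intro h
        obtain rfl := hT.tail_unique z x y (hFT h) hxT
        exact hxF h
      have hFe : F ⊆ S.erase (z, y) := subset_erase.2 ⟨hFS, hzF⟩
      exact step _ hz hFe (hS.swap_head hFe hx hz)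
    · push Not at hy
      obtain ⟨e, he, hFe, harb⟩ := hS.exists_erase hF hssub'
      refine step e he hFe (harb.insert_arc (reflTransGen_arcRel_mono hFe hx) ?_ ?_)
      · rintro rfl
        exact hT.not_mem_root x hxT
      · exact fun a ha => hy a (mem_of_mem_erase ha)

theorem exists_reconfStep_root {A T : Finset (V × V)} {u v : V} (hTA : T ⊆ A)
    (hT : IsArborescence T v) (hne : T.Nonempty) (huv : u ≠ v) (harc : (u, v) ∈ A) :
    ∃ S, IsArborescence S u ∧ ReconfStep A T.card T S := by
  have hnot : (u, v) ∉ T := hT.not_mem_root u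
  by_cases hu : ∃ p, (p, u) ∈ T
  · obtain ⟨p, hp⟩ := hu
    have harb : IsArborescence (insert (u, v) (T.erase (p, u))) u := by
      refine IsArborescence.insert_root (erase_subset _ _) hT huv ?_ ?_
      · intro a ha
        obtain rfl := hT.tail_unique a p u (mem_of_mem_erase ha) hp
        exact notMem_erase _ _ ha
      · exact fun a b hab hb => mem_erase.2 ⟨fun h => hb (Prod.mk.inj h).2, hab⟩
    exact ⟨_, harb, reconfStep_swap hTA hT hp hnot harc harb⟩
  · push Not at hu
    obtain ⟨e, he, -, hE⟩ := hT.exists_erase (isArborescence_empty v) hne.empty_ssubset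
    have harb : IsArborescence (insert (u, v) (T.erase e)) u :=
      IsArborescence.insert_root Subset.rfl hE huv (fun a ha => hu a (mem_of_mem_erase ha))
        fun _ _ hab _ => hab
    exact ⟨_, harb, reconfStep_swap hTA hT he hnot harc harb⟩

theorem reconf_of_adjacent_roots {A S T : Finset (V × V)} {u v : V} (hSA : S ⊆ A) (hTA : T ⊆ A)
    (hS : IsArborescence S u) (hT : IsArborescence T v) (hcard : S.card = T.card)
    (hne : T.Nonempty) (huv : u ≠ v) (harc : (u, v) ∈ A) :
    ReflTransGen (ReconfStep A T.card) S T := by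
  obtain ⟨R, hR, hstep⟩ := exists_reconfStep_root hTA hT hne huv harc
  have hRcard : R.card = T.card := hstep.2.1.2.2
  have h := reconf_of_common_subtree hSA hstep.2.1.1 hS hR (hcard.trans hRcard.symm)
    (isArborescence_empty u) (empty_subset _) (empty_subset _)
  exact (hRcard ▸ h).tail (symm hstep)

theorem exists_sequence_of_reconf {A S T : Finset (V × V)} {k : ℕ} (hT : IsTreeIn A k T)
    (h : ReflTransGen (ReconfStep A k) S T) :
    ∃ ℓ, ∃ f : ℕ → Finset (V × V), f 0 = S ∧ f ℓ = T ∧ (∀ i ≤ ℓ, IsTreeIn A k (f i)) ∧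
      ∀ i < ℓ, (f i \ f (i + 1)).card = 1 ∧ (f (i + 1) \ f i).card = 1 := by
  induction h using ReflTransGen.head_induction_on with
  | refl => exact ⟨0, fun _ => T, rfl, rfl, fun _ _ => hT, fun i hi => absurd hi (by omega)⟩
  | @head S R hSR _ ih =>
    obtain ⟨ℓ, f, rfl, hℓ, htree, hstep⟩ := ih
    refine ⟨ℓ + 1, fun i => Nat.casesOn i S f, rfl, hℓ, ?_, ?_⟩
    · rintro (_ | i) hi
      · exact hSR.1
      · exact htree i (by omega)
    · rintro (_ | i) hi
      · exact hSR.2.2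
      · exact hstep i (by omega)

end

/-- If `u ≠ v` and `G` has an arc `(u, v)` or `(v, u)`, then any `u`-directed tree with
`k` arcs and any `v`-directed tree with `k` arcs in `G` are connected by a
reconfiguration sequence of directed trees with `k` arcs in `G`. -/
theorem stmt9 {V : Type*} [Fintype V] [DecidableEq V] (A : Finset (V × V))
    (k : ℕ) (hk : 0 < k) (u v : V) (huv : u ≠ v) (harc : (u, v) ∈ A ∨ (v, u) ∈ A)
    (T T' : Finset (V × V)) (hTA : T ⊆ A) (hT'A : T' ⊆ A)
    (hT : IsDirTree T u) (hT' : IsDirTree T' v)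
    (hkT : T.card = k) (hkT' : T'.card = k) :
    ∃ ℓ, ∃ f : ℕ → Finset (V × V), f 0 = T ∧ f ℓ = T' ∧
      (∀ i ≤ ℓ, f i ⊆ A ∧ (∃ r, IsDirTree (f i) r) ∧ (f i).card = k) ∧
      (∀ i < ℓ, (f i \ f (i + 1)).card = 1 ∧ (f (i + 1) \ f i).card = 1) := by
  rw [isDirTree_iff_isArborescence] at hT hT'
  have hcard : T.card = T'.card := hkT.trans hkT'.symm
  refine exists_sequence_of_reconf
    ⟨hT'A, ⟨v, isDirTree_iff_isArborescence.2 hT'⟩, hkT'⟩ ?_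
  rcases harc with h | h
  · rw [← hkT']
    exact reconf_of_adjacent_roots hTA hT'A hT hT' hcard (card_pos.1 (by omega)) huv h
  · rw [← hkT]
    exact symm
      (reconf_of_adjacent_roots hT'A hTA hT' hT hcard.symm (card_pos.1 (by omega)) huv.symm h)
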